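/- arXiv:1307.1577 — 3 statements merged into one kernel-verified Lean document; each statement's English description precedes it below -/
import Mathlib

section
/- Let B be the Minkowski bilinear form on ℝ^{n+1} and let x, y, z, u be four pairwise distinct points of the hyperboloid ℍⁿ = {w ∈ ℝ^{n+1} : B(w,w) = 1, w₀ > 0} (n ≥ 2). If B(x − B(x,y)y, z − B(z,y)y) = 0, B(x − B(x,y)y, u − B(u,y)y) = 0, and B(u − B(u,z)z, y − B(y,z)z) = 0 (i.e., the hyperbolic triangles xyz, xyu, yzu are right at y, y and z respectively), then B(x − B(x,z)z, u − B(u,z)z) = 0 (i.e., the hyperbolic triangle xzu is right at z). -/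
/-- The Minkowski bilinear form on `ℝ^{n+1}`:
`B x y = x₀ y₀ - x₁ y₁ - ⋯ - xₙ yₙ`. -/
def minkowskiForm (n : ℕ) (x y : Fin (n + 1) → ℝ) : ℝ :=
  x 0 * y 0 - ∑ i : Fin n, x i.succ * y i.succ

/-- The hyperboloid model `ℍⁿ = {w : B(w,w) = 1, w₀ > 0}` of hyperbolic
`n`-space. -/
def hyperboloid (n : ℕ) : Set (Fin (n + 1) → ℝ) :=
  {w | minkowskiForm n w w = 1 ∧ 0 < w 0}

theorem minkowskiForm_comm (n : ℕ) (x y : Fin (n + 1) → ℝ) :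
    minkowskiForm n x y = minkowskiForm n y x := by
  simp only [minkowskiForm, mul_comm]

theorem minkowskiForm_sub_left (n : ℕ) (x y z : Fin (n + 1) → ℝ) :
    minkowskiForm n (x - y) z = minkowskiForm n x z - minkowskiForm n y z := by
  simp only [minkowskiForm, Pi.sub_apply, sub_mul, Finset.sum_sub_distrib]
  ring

theorem minkowskiForm_smul_left (n : ℕ) (c : ℝ) (x y : Fin (n + 1) → ℝ) :
    minkowskiForm n (c • x) y = c * minkowskiForm n x y := by
  simp only [minkowskiForm, Pi.smul_apply, smul_eq_mul, mul_assoc, mul_sub, Finset.mul_sum]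

/-- The Minkowski form of two vectors projected to the orthogonal complement of a unit
timelike vector `y`. -/
theorem minkowskiForm_sub_smul_sub_smul {n : ℕ} {y : Fin (n + 1) → ℝ}
    (hy : minkowskiForm n y y = 1) (a c : Fin (n + 1) → ℝ) :
    minkowskiForm n (a - minkowskiForm n a y • y) (c - minkowskiForm n c y • y) =
      minkowskiForm n a c - minkowskiForm n a y * minkowskiForm n c y := by
  have hy_orth : minkowskiForm n (c - minkowskiForm n c y • y) y = 0 := by
    rw [minkowskiForm_sub_left, minkowskiForm_smul_left, hy, mul_one, sub_self]
  rw [minkowskiForm_sub_left, minkowskiForm_smul_left,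
    minkowskiForm_comm n y, hy_orth, minkowskiForm_comm n a (c - _),
    minkowskiForm_sub_left, minkowskiForm_smul_left, minkowskiForm_comm n c a,
    minkowskiForm_comm n y a]
  ring

/-- **Theorem of the three perpendiculars in hyperbolic space (Gupta's form).**
If the hyperbolic triangles `xyz`, `xyu`, `yzu` are right at `y`, `y` and `z`
respectively, then the hyperbolic triangle `xzu` is right at `z`. -/
theorem three_perpendiculars_hyperbolic
    {n : ℕ} (hn : 2 ≤ n)
    (x y z u : Fin (n + 1) → ℝ)
    (hx : x ∈ hyperboloid n) (hy : y ∈ hyperboloid n)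
    (hz : z ∈ hyperboloid n) (hu : u ∈ hyperboloid n)
    (hxy : x ≠ y) (hxz : x ≠ z) (hxu : x ≠ u)
    (hyz : y ≠ z) (hyu : y ≠ u) (hzu : z ≠ u)
    (h1 : minkowskiForm n (x - minkowskiForm n x y • y)
      (z - minkowskiForm n z y • y) = 0)
    (h2 : minkowskiForm n (x - minkowskiForm n x y • y)
      (u - minkowskiForm n u y • y) = 0)
    (h3 : minkowskiForm n (u - minkowskiForm n u z • z)
      (y - minkowskiForm n y z • z) = 0) :
    minkowskiForm n (x - minkowskiForm n x z • z)
      (u - minkowskiForm n u z • z) = 0 := by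
  rw [minkowskiForm_sub_smul_sub_smul hy.1] at h1 h2
  rw [minkowskiForm_sub_smul_sub_smul hz.1] at h3 ⊢
  rw [minkowskiForm_comm n z y] at h1
  linear_combination
    h2 - minkowskiForm n u z * h1 + minkowskiForm n x y * h3
end

section
/- Let B be the Minkowski bilinear form on ℝ³, B(x,y) = x₀y₀ − x₁y₁ − x₂y₂, let a > 1, let F = {x ∈ ℝ³ : x₀ = a x₁}, and let f : ℝ³ → ℝ³ be the B-orthogonal projection onto F. If x ∈ ℝ³ satisfies B(x, x) > 0 and x₀ > 0, then B(f(x), f(x)) > 0 and the first coordinate of f(x) is positive. In other words, the domain D = {x ∈ ℝ³ : B(x,x) > 0, x₀ > 0} is stable under f. -/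
/-- The Minkowski bilinear form on `ℝ³`: `B x y = x₀y₀ - x₁y₁ - x₂y₂`. -/
def minkowski3 (x y : Fin 3 → ℝ) : ℝ :=
  x 0 * y 0 - x 1 * y 1 - x 2 * y 2

/-- **Stability of the domain `D = {B(x,x) > 0, x₀ > 0}` under the
`B`-orthogonal projection onto the plane `x₀ = a x₁` (`a > 1`).** -/
theorem minkowski_proj_stable
    (a : ℝ) (ha : 1 < a)
    (f : (Fin 3 → ℝ) →ₗ[ℝ] (Fin 3 → ℝ))
    (hfF : ∀ x : Fin 3 → ℝ, (f x) 0 = a * (f x) 1)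
    (hf : ∀ x w : Fin 3 → ℝ, w 0 = a * w 1 → minkowski3 (x - f x) w = 0) :
    ∀ x : Fin 3 → ℝ, 0 < minkowski3 x x → 0 < x 0 →
      0 < minkowski3 (f x) (f x) ∧ 0 < (f x) 0 := by
  intro x hx hx0
  have h2 := hf x ![0, 0, 1] (by simp)
  have h1 := hf x ![a, 1, 0] (by simp)
  have hF := hfF x
  simp only [minkowski3, Pi.sub_apply, Matrix.cons_val, mul_zero, mul_one, sub_zero, zero_sub]
    at h1 h2 hx ⊢
  rw [hF] at h1 ⊢
  have h2' : f x 2 = x 2 := by linarith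
  rw [h2']
  have ha2 : 0 < a ^ 2 - 1 := by nlinarith
  have hkey : (a ^ 2 - 1) * f x 1 = a * x 0 - x 1 := by linarith
  have hlt : x 1 < x 0 := by nlinarith [sq_nonneg (x 2)]
  have hpos : 0 < f x 1 := by
    refine pos_of_mul_pos_right (a := a ^ 2 - 1) ?_ ha2.le
    rw [hkey]
    nlinarith
  refine ⟨?_, by positivity⟩
  have hsq : (a ^ 2 - 1) * ((a ^ 2 - 1) * f x 1 ^ 2 - (x 0 ^ 2 - x 1 ^ 2))
      = (x 0 - a * x 1) ^ 2 := by
    linear_combination ((a ^ 2 - 1) * f x 1 + (a * x 0 - x 1)) * hkey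
  have hle : 0 ≤ (a ^ 2 - 1) * f x 1 ^ 2 - (x 0 ^ 2 - x 1 ^ 2) :=
    nonneg_of_mul_nonneg_right (hsq ▸ sq_nonneg _) ha2
  linarith
end

section
/- Let B be the Minkowski bilinear form on ℝ^{n+1}, let G ⊆ F be linear subspaces of ℝ^{n+1} with 2 ≤ dim G < dim F ≤ n whose intersections with the hyperboloid ℍⁿ = {w : B(w,w) = 1, w₀ > 0} are nonempty, and let x, y, z ∈ ℍⁿ be pairwise distinct points with x ∉ F, y ∈ F \ G, z ∈ G. If B(x − B(x,y)y, w) = 0 for all w ∈ F with B(w,y) = 0 (the geodesic xy is orthogonal at y to F ∩ ℍⁿ), and B(y − B(y,z)z, w) = 0 for all w ∈ G with B(w,z) = 0 (the geodesic yz is orthogonal at z to G ∩ ℍⁿ), then B(x − B(x,z)z, w) = 0 for all w ∈ G with B(w,z) = 0 (the geodesic xz is orthogonal at z to G ∩ ℍⁿ). -/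
theorem minkowskiForm_sub_smul_left (n : ℕ) (c : ℝ) (x y w : Fin (n + 1) → ℝ) :
    minkowskiForm n (x - c • y) w = minkowskiForm n x w - c * minkowskiForm n y w := by
  simp only [minkowskiForm, Pi.sub_apply, Pi.smul_apply, smul_eq_mul, sub_mul,
    Finset.sum_sub_distrib, mul_assoc, ← Finset.mul_sum]
  ring

/-- **Theorem of the three perpendiculars in hyperbolic space, for
`p`-spaces.** If the geodesic `x y` is orthogonal at `y` to `F ∩ ℍⁿ` and the
geodesic `y z` is orthogonal at `z` to `G ∩ ℍⁿ` (`G ⊆ F`), then the geodesic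
`x z` is orthogonal at `z` to `G ∩ ℍⁿ`. -/
theorem three_perpendiculars_hyperbolic_subspaces
    {n : ℕ} (F G : Submodule ℝ (Fin (n + 1) → ℝ))
    (hGF : G ≤ F)
    (hG2 : 2 ≤ Module.finrank ℝ G)
    (hGFdim : Module.finrank ℝ G < Module.finrank ℝ F)
    (hFn : Module.finrank ℝ F ≤ n)
    (hFH : ∃ w ∈ F, w ∈ hyperboloid n)
    (hGH : ∃ w ∈ G, w ∈ hyperboloid n)
    (x y z : Fin (n + 1) → ℝ)
    (hx : x ∈ hyperboloid n) (hy : y ∈ hyperboloid n) (hz : z ∈ hyperboloid n)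
    (hxy : x ≠ y) (hxz : x ≠ z) (hyz : y ≠ z)
    (hxF : x ∉ F) (hyF : y ∈ F) (hyG : y ∉ G) (hzG : z ∈ G)
    (h1 : ∀ w ∈ F, minkowskiForm n w y = 0 →
      minkowskiForm n (x - minkowskiForm n x y • y) w = 0)
    (h2 : ∀ w ∈ G, minkowskiForm n w z = 0 →
      minkowskiForm n (y - minkowskiForm n y z • z) w = 0) :
    ∀ w ∈ G, minkowskiForm n w z = 0 →
      minkowskiForm n (x - minkowskiForm n x z • z) w = 0 := by
  intro w hw hwz
  have hzw : minkowskiForm n z w = 0 := by rw [minkowskiForm_comm, hwz]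
  have hyw : minkowskiForm n y w = 0 := by
    simpa [minkowskiForm_sub_smul_left, hzw] using h2 w hw hwz
  have hxw : minkowskiForm n x w = 0 := by
    simpa [minkowskiForm_sub_smul_left, hyw] using
      h1 w (hGF hw) (by rw [minkowskiForm_comm, hyw])
  simp [minkowskiForm_sub_smul_left, hxw, hzw]
end
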